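/- arXiv:1601.03436 — 3 statements merged into one kernel-verified Lean document; each statement's English description precedes it below -/
import Mathlib

section
/- Let R be an associative unital ring and M a left R-module that is projective in σ[M] and semiprime. Then M has finite uniform dimension and enough monoforms if and only if M is a Goldie module. -/
universe u v

section Defs

variable (R : Type u) [Ring R] (M : Type v) [AddCommGroup M] [Module R M]

/-- The product `K ·_M L` of submodules: the sum of all images `f K` over `f : M → L`. -/
def prodM (K L : Submodule R M) : Submodule R M :=
  ⨆ (f : M →ₗ[R] M) (_ : LinearMap.range f ≤ L), K.map f

/-- A submodule is fully invariant if it is stable under every endomorphism. -/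
def IsFullyInvariant (N : Submodule R M) : Prop :=
  ∀ f : M →ₗ[R] M, N.map f ≤ N

/-- A fully invariant submodule `N` is prime in `M` if `K ·_M L ≤ N` implies `K ≤ N` or
`L ≤ N` for all fully invariant submodules `K, L`. -/
def IsPrimeSubmodule (N : Submodule R M) : Prop :=
  IsFullyInvariant R M N ∧
    ∀ K L : Submodule R M, IsFullyInvariant R M K → IsFullyInvariant R M L →
      prodM R M K L ≤ N → K ≤ N ∨ L ≤ N

/-- A fully invariant submodule `N` is semiprime in `M` if `K ·_M K ≤ N` implies `K ≤ N`
for every fully invariant submodule `K`. -/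
def IsSemiprimeSubmodule (N : Submodule R M) : Prop :=
  IsFullyInvariant R M N ∧
    ∀ K : Submodule R M, IsFullyInvariant R M K → prodM R M K K ≤ N → K ≤ N

/-- `M` is a semiprime module if `⊥` is semiprime in `M`. -/
def IsSemiprimeModule : Prop := IsSemiprimeSubmodule R M ⊥

/-- `M` is a prime module if `⊥` is prime in `M`. -/
def IsPrimeModule : Prop := IsPrimeSubmodule R M ⊥

/-- A minimal prime submodule: prime and minimal among prime submodules. -/
def IsMinimalPrimeSubmodule (P : Submodule R M) : Prop :=
  IsPrimeSubmodule R M P ∧ ∀ Q : Submodule R M, IsPrimeSubmodule R M Q → Q ≤ P → Q = P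

/-- `X` is `M`-generated: a homomorphic image of a direct sum of copies of `M`. -/
def IsMGenerated (X : Type v) [AddCommGroup X] [Module R X] : Prop :=
  ∃ (ι : Type v) (f : (ι →₀ M) →ₗ[R] X), Function.Surjective f

/-- `X` belongs to `σ[M]`: isomorphic to a submodule of an `M`-generated module. -/
def InSigmaM (X : Type v) [AddCommGroup X] [Module R X] : Prop :=
  ∃ (Y : Type v) (_ : AddCommGroup Y) (_ : Module R Y),
    IsMGenerated R M Y ∧ ∃ g : X →ₗ[R] Y, Function.Injective g

/-- `M` is projective in `σ[M]`. -/
def ProjectiveInSigmaM : Prop :=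
  ∀ (A B : Type v) [AddCommGroup A] [Module R A] [AddCommGroup B] [Module R B],
    InSigmaM R M A → InSigmaM R M B →
      ∀ g : A →ₗ[R] B, Function.Surjective g →
        ∀ h : M →ₗ[R] B, ∃ f : M →ₗ[R] A, g ∘ₗ f = h

/-- `N` is essential in `M`. -/
def IsEssentialSub (N : Submodule R M) : Prop :=
  ∀ L : Submodule R M, L ≠ ⊥ → N ⊓ L ≠ ⊥

/-- `M` has finite uniform dimension: no infinite independent family of nonzero submodules. -/
def HasFinUdim : Prop :=
  ¬ ∃ f : ℕ → Submodule R M, (∀ n, f n ≠ ⊥) ∧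
      ∀ n, Disjoint (f n) (⨆ (m) (_ : m ≠ n), f m)

/-- A left annihilator in `M`: an intersection `⋂_{f ∈ X} ker f` with `X ⊆ End_R(M)`. -/
def IsLeftAnnihilatorSub (N : Submodule R M) : Prop :=
  ∃ X : Set (M →ₗ[R] M), N = ⨅ f ∈ X, LinearMap.ker f

/-- ACC on left annihilators. -/
def AccLeftAnnihilators : Prop :=
  ∀ a : ℕ → Submodule R M, (∀ n, IsLeftAnnihilatorSub R M (a n)) → Monotone a →
    ∃ n, ∀ m, n ≤ m → a m = a n

/-- `M` is a Goldie module: ACC on left annihilators and finite uniform dimension. -/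
def IsGoldieModule : Prop := AccLeftAnnihilators R M ∧ HasFinUdim R M

/-- `Ann_M(K) = ⋂ { ker f | f ∈ Hom_R(M, K) }`. -/
def annM (K : Submodule R M) : Submodule R M :=
  ⨅ (f : M →ₗ[R] M) (_ : LinearMap.range f ≤ K), LinearMap.ker f

/-- `N` is an annihilator submodule: `N = Ann_M(K)` for some nonzero submodule `K`. -/
def IsAnnihilatorSub (N : Submodule R M) : Prop :=
  ∃ K : Submodule R M, K ≠ ⊥ ∧ N = annM R M K

/-- A submodule `U` is uniform: nonzero and every nonzero submodule of `U` is essential in `U`. -/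
def IsUniformSub (U : Submodule R M) : Prop :=
  U ≠ ⊥ ∧ ∀ A B : Submodule R M, A ≤ U → B ≤ U → A ≠ ⊥ → B ≠ ⊥ → A ⊓ B ≠ ⊥

/-- A submodule `U` is monoform: nonzero and every nonzero homomorphism `L → U` from a
submodule `L ≤ U` is injective. -/
def IsMonoformSub (U : Submodule R M) : Prop :=
  U ≠ ⊥ ∧ ∀ L : Submodule R M, L ≤ U → ∀ f : L →ₗ[R] U, f ≠ 0 → Function.Injective f

/-- `M` has enough monoforms: every nonzero submodule contains a monoform submodule. -/
def HasEnoughMonoforms : Prop :=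
  ∀ N : Submodule R M, N ≠ ⊥ → ∃ U : Submodule R M, U ≤ N ∧ IsMonoformSub R M U

/-- `M` is weakly compressible. -/
def WeaklyCompressible : Prop :=
  ∀ N : Submodule R M, N ≠ ⊥ → ∃ f : M →ₗ[R] M, LinearMap.range f ≤ N ∧ f ∘ₗ f ≠ 0

/-- `M` is retractable: `Hom_R(M, N) ≠ 0` for every nonzero submodule `N`. -/
def Retractable : Prop :=
  ∀ N : Submodule R M, N ≠ ⊥ → ∃ f : M →ₗ[R] M, LinearMap.range f ≤ N ∧ f ≠ 0

/-- Powers of a fully invariant submodule: `J^0 = ⊥`, `J^1 = J`, `J^(m+1) = J ·_M J^m`. -/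
def fipow (J : Submodule R M) : ℕ → Submodule R M
  | 0 => ⊥
  | 1 => J
  | n + 2 => prodM R M J (fipow J (n + 1))

end Defs

section RingDefs

variable (S : Type*) [Ring S]

/-- A ring is semiprime: no nonzero two-sided ideal squares to zero. -/
def IsSemiprimeRing : Prop :=
  ∀ I : TwoSidedIdeal S, (∀ a ∈ I, ∀ b ∈ I, a * b = 0) → I = ⊥

/-- A ring is prime: `I · J = 0` forces `I = 0` or `J = 0` for two-sided ideals. -/
def IsPrimeRing : Prop :=
  ∀ I J : TwoSidedIdeal S, (∀ a ∈ I, ∀ b ∈ J, a * b = 0) → I = ⊥ ∨ J = ⊥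

/-- A right annihilator subset of `S`: `{ s | X s = 0 }` for some `X ⊆ S`. -/
def IsRightAnnihilatorSet (T : Set S) : Prop :=
  ∃ X : Set S, T = {s : S | ∀ x ∈ X, x * s = 0}

/-- ACC on right annihilators of the ring `S`. -/
def AccRightAnnihilators : Prop :=
  ∀ a : ℕ → Set S, (∀ n, IsRightAnnihilatorSet S (a n)) → (∀ n, a n ⊆ a (n + 1)) →
    ∃ n, ∀ m, n ≤ m → a m = a n

/-- `S` is a right Goldie ring: ACC on right annihilators and finite uniform dimension
as a right `S`-module. -/
def IsRightGoldieRing : Prop :=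
  AccRightAnnihilators S ∧ HasFinUdim Sᵐᵒᵖ S

end RingDefs

section Helpers

variable {R : Type u} [Ring R] {M : Type v} [AddCommGroup M] [Module R M]

theorem inSigmaM_of_injective {X : Type v} [AddCommGroup X] [Module R X] {ι : Type v}
    (g : X →ₗ[R] (ι →₀ M)) (hg : Function.Injective g) : InSigmaM R M X :=
  ⟨ι →₀ M, inferInstance, inferInstance, ⟨ι, LinearMap.id, Function.surjective_id⟩, g, hg⟩

theorem inSigmaM_of_injective_self {X : Type v} [AddCommGroup X] [Module R X]
    (g : X →ₗ[R] M) (hg : Function.Injective g) : InSigmaM R M X :=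
  inSigmaM_of_injective (Finsupp.lsingle (PUnit.unit : PUnit.{v + 1}) ∘ₗ g)
    ((Finsupp.single_injective _).comp hg)

/-- A linear map into the range of `f : A → M` lifts along `f` when `A` lies in `σ[M]`. -/
theorem ProjectiveInSigmaM.exists_lift (hproj : ProjectiveInSigmaM R M)
    {A : Type v} [AddCommGroup A] [Module R A] (hA : InSigmaM R M A)
    (f : A →ₗ[R] M) (g : M →ₗ[R] M) (hg : LinearMap.range g ≤ LinearMap.range f) :
    ∃ h : M →ₗ[R] A, ∀ m, f (h m) = g m := by
  obtain ⟨h, hh⟩ := hproj A (LinearMap.range f) hA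
    (inSigmaM_of_injective_self (LinearMap.range f).subtype Subtype.val_injective)
    f.rangeRestrict f.surjective_rangeRestrict
    (g.codRestrict _ fun m => hg ⟨m, rfl⟩)
  exact ⟨h, fun m => congrArg Subtype.val (LinearMap.congr_fun hh m)⟩

/-- In a semiprime module projective in `σ[M]`, no nonzero submodule `N` has
`N ·_M N = 0`. -/
theorem exists_range_le_apply_ne_zero (hproj : ProjectiveInSigmaM R M)
    (hsemi : IsSemiprimeModule R M) {N : Submodule R M} (hN : N ≠ ⊥) :
    ∃ f : M →ₗ[R] M, LinearMap.range f ≤ N ∧ ∃ x ∈ N, f x ≠ 0 := by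
  by_contra! hc
  let P : ((M →ₗ[R] M) →₀ N) →ₗ[R] M := Finsupp.lsum ℕ fun g => g ∘ₗ N.subtype
  have hP : ∀ g n, P (Finsupp.single g n) = g n := fun g n => by simp [P]
  have hinv : IsFullyInvariant R M (LinearMap.range P) := by
    rintro f _ ⟨_, ⟨s, rfl⟩, rfl⟩
    induction s using Finsupp.induction_linear with
    | zero => simp
    | add s t hs ht => rw [map_add, map_add]; exact add_mem hs ht
    | single g n => exact ⟨Finsupp.single (f ∘ₗ g) n, by rw [hP, hP]; rfl⟩
  have hzero : prodM R M (LinearMap.range P) (LinearMap.range P) ≤ ⊥ := by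
    refine iSup₂_le fun f hf => ?_
    rintro _ ⟨_, ⟨s, rfl⟩, rfl⟩
    rw [Submodule.mem_bot]
    induction s using Finsupp.induction_linear with
    | zero => simp
    | add s t hs ht => rw [map_add, map_add, hs, ht, add_zero]
    | single g n =>
      have hA : InSigmaM R M ((M →ₗ[R] M) →₀ N) :=
        inSigmaM_of_injective (Finsupp.mapRange.linearMap N.subtype)
          (Finsupp.mapRange_injective _ rfl Subtype.val_injective)
      obtain ⟨h, hh⟩ := hproj.exists_lift hA P (f ∘ₗ g)
        ((LinearMap.range_comp_le_range g f).trans hf)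
      have hn : h n = 0 := by
        ext g'
        refine hc (N.subtype ∘ₗ Finsupp.lapply g' ∘ₗ h) ?_ n n.2
        rintro _ ⟨m, rfl⟩
        exact (h m g').2
      rw [hP]
      exact (hh n).symm.trans (by rw [hn, map_zero])
  refine hN (eq_bot_iff.2 fun x hx => hsemi.2 _ hinv hzero ?_)
  exact ⟨Finsupp.single LinearMap.id ⟨x, hx⟩, hP _ _⟩

/-- A linear map `f : B → M` with essential kernel yields, for every nonzero `W` in its range,
an endomorphism of `M` with essential kernel, mapping into `W` and nonzero on `W`. -/
theorem exists_essential_ker_of_le_range (hproj : ProjectiveInSigmaM R M)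
    (hsemi : IsSemiprimeModule R M) {B : Submodule R M} (f : B →ₗ[R] M)
    (hf : ∀ L : Submodule R M, L ≤ B → L ≠ ⊥ → ∃ x : B, (x : M) ∈ L ∧ x ≠ 0 ∧ f x = 0)
    {W : Submodule R M} (hW : W ≤ LinearMap.range f) (hW0 : W ≠ ⊥) :
    ∃ g : M →ₗ[R] M, LinearMap.range g ≤ W ∧ (∃ w ∈ W, g w ≠ 0) ∧
      IsEssentialSub R M (LinearMap.ker g) := by
  obtain ⟨g, hgW, hg0⟩ := exists_range_le_apply_ne_zero hproj hsemi hW0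
  refine ⟨g, hgW, hg0, fun L hL => ?_⟩
  obtain ⟨h, hh⟩ := hproj.exists_lift
    (inSigmaM_of_injective_self B.subtype Subtype.val_injective) f g (hgW.trans hW)
  by_cases h0 : L.map (B.subtype ∘ₗ h) = ⊥
  · have hle : L ≤ LinearMap.ker g := fun x hx => by
      have hx0 : ((h x : B) : M) ∈ L.map (B.subtype ∘ₗ h) := ⟨x, hx, rfl⟩
      rw [h0, Submodule.mem_bot, ZeroMemClass.coe_eq_zero] at hx0
      rw [LinearMap.mem_ker, ← hh, hx0, map_zero]
    rwa [inf_eq_right.2 hle]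
  · have hle : L.map (B.subtype ∘ₗ h) ≤ B := by
      rintro _ ⟨x, -, rfl⟩
      exact (h x).2
    obtain ⟨y, ⟨x, hx, hxy⟩, hy0, hfy⟩ := hf _ hle h0
    have hxy' : h x = y := Subtype.ext hxy
    refine (Submodule.ne_bot_iff _).2 ⟨x, ⟨?_, hx⟩, ?_⟩
    · exact (hh x).symm.trans (by rw [hxy', hfy])
    · rintro rfl
      exact hy0 (by rw [← hxy', map_zero])

/-- A sequence of nonzero submodules, each disjoint from a stage of an increasing chain
containing the previous ones, contradicts finite uniform dimension. -/
theorem HasFinUdim.false_of_disjoint (hfin : HasFinUdim R M) (f a : ℕ → Submodule R M)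
    (hf : ∀ n, f n ≠ ⊥) (hd : ∀ n, Disjoint (f n) (a n)) (hle : ∀ m n, m < n → f m ≤ a n) :
    False := by
  refine hfin ⟨f, hf, ?_⟩
  suffices h : iSupIndep f from h
  refine iSupIndep_iff_supIndep.2 fun s => ?_
  obtain ⟨n, hs⟩ := s.exists_nat_subset_range
  refine Finset.SupIndep.subset ?_ hs
  clear hs
  induction n with
  | zero => exact Finset.supIndep_empty f
  | succ n ih =>
    rw [Finset.range_add_one]
    exact ih.insert ((hd n).mono_right (Finset.sup_le fun m hm => hle m n (Finset.mem_range.1 hm)))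

theorem HasFinUdim.exists_uniform (hfin : HasFinUdim R M) {N : Submodule R M} (hN : N ≠ ⊥) :
    ∃ U ≤ N, IsUniformSub R M U := by
  by_contra! hc
  have hstep : ∀ X : {X : Submodule R M // X ≤ N ∧ X ≠ ⊥},
      ∃ (A : Submodule R M) (Y : {X : Submodule R M // X ≤ N ∧ X ≠ ⊥}),
        A ≤ X ∧ Y.1 ≤ X ∧ A ≠ ⊥ ∧ Disjoint A Y.1 := by
    rintro ⟨X, hXN, hX0⟩
    have h := hc X hXN
    simp only [IsUniformSub, not_and, not_forall, not_not] at h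
    obtain ⟨A, B, hA, hB, hA0, hB0, hAB⟩ := h hX0
    exact ⟨A, ⟨B, hB.trans hXN, hB0⟩, hA, hB, hA0, disjoint_iff.2 hAB⟩
  choose A Y hAX hYX hA0 hAY using hstep
  let X : ℕ → {X : Submodule R M // X ≤ N ∧ X ≠ ⊥} := fun n => Y^[n] ⟨N, le_rfl, hN⟩
  have hX : ∀ n, X (n + 1) = Y (X n) := fun n => Function.iterate_succ_apply' _ _ _
  have hdisj : ∀ n, Disjoint (⨆ m < n, A (X m)) (X n).1 := by
    intro n
    induction n with
    | zero => simp
    | succ n ih =>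
      rw [Nat.iSup_lt_succ, hX]
      exact (hAY _).disjoint_sup_left_of_disjoint_sup_right
        (ih.mono_right (sup_le (hAX _) (hYX _)))
  exact hfin.false_of_disjoint (fun n => A (X n)) (fun n => ⨆ m < n, A (X m)) (fun n => hA0 _)
    (fun n => ((hdisj n).mono_right (hAX _)).symm) fun m n hmn => le_iSup₂_of_le m hmn le_rfl

/-- Under the ascending chain condition on left annihilators, endomorphisms with essential
kernel vanish. -/
theorem AccLeftAnnihilators.eq_zero_of_essential_ker (hacc : AccLeftAnnihilators R M)
    (hproj : ProjectiveInSigmaM R M) (hsemi : IsSemiprimeModule R M) (f : M →ₗ[R] M)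
    (hf : IsEssentialSub R M (LinearMap.ker f)) : f = 0 := by
  by_contra hf0
  let Z : Type v := {f : M →ₗ[R] M // f ≠ 0 ∧ IsEssentialSub R M (LinearMap.ker f)}
  obtain ⟨⟨f, hf0, hf⟩, hmax⟩ : ∃ f : Z, ∀ g : Z,
      ¬ LinearMap.ker f.1 < LinearMap.ker g.1 := by
    by_contra! hc
    choose s hs using hc
    let a : ℕ → Z := fun n => s^[n] ⟨f, hf0, hf⟩
    have ha : StrictMono fun n => LinearMap.ker (a n).1 := strictMono_nat_of_lt_succ fun n => by
      simp only [a, Function.iterate_succ_apply']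
      exact hs _
    obtain ⟨n, hn⟩ := hacc _ (fun n => ⟨{(a n).1}, by simp⟩) ha.monotone
    exact (ha n.lt_succ_self).ne' (hn _ n.le_succ)
  have hfgf : ∀ g : M →ₗ[R] M, ∀ x, f (g (f x)) = 0 := by
    by_contra! hc
    obtain ⟨g, x, hx⟩ := hc
    have hle : LinearMap.ker f ≤ LinearMap.ker (f ∘ₗ g ∘ₗ f) := fun y hy => by
      simp [LinearMap.mem_ker.1 hy]
    refine hmax ⟨f ∘ₗ g ∘ₗ f, fun h => hx (LinearMap.congr_fun h x),
      fun L hL h => hf L hL (eq_bot_mono (inf_le_inf_right _ hle) h)⟩ (lt_of_le_of_ne hle ?_)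
    intro heq
    by_cases h0 : (LinearMap.range f).map g = ⊥
    · have : g (f x) ∈ (LinearMap.range f).map g := ⟨f x, ⟨x, rfl⟩, rfl⟩
      rw [h0, Submodule.mem_bot] at this
      exact hx (by rw [this, map_zero])
    · obtain ⟨y, ⟨hy, _, ⟨z, rfl⟩, rfl⟩, hy0⟩ := (Submodule.ne_bot_iff _).1 (hf _ h0)
      have hz : z ∈ LinearMap.ker (f ∘ₗ g ∘ₗ f) := hy
      rw [← show LinearMap.ker f = _ from heq, LinearMap.mem_ker] at hz
      exact hy0 (by rw [hz, map_zero])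
  obtain ⟨u, hu, _, ⟨x, rfl⟩, hx⟩ := exists_range_le_apply_ne_zero hproj hsemi
    (N := LinearMap.range f) (by rwa [Ne, LinearMap.range_eq_bot])
  obtain ⟨g, hg⟩ := hproj.exists_lift
    (inSigmaM_of_injective_self LinearMap.id Function.injective_id) f u hu
  exact hx (by rw [← hg, hfgf])

theorem HasEnoughMonoforms.eq_zero_of_essential_ker (hmono : HasEnoughMonoforms R M)
    (hproj : ProjectiveInSigmaM R M) (hsemi : IsSemiprimeModule R M) (f : M →ₗ[R] M)
    (hf : IsEssentialSub R M (LinearMap.ker f)) : f = 0 := by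
  by_contra hf0
  obtain ⟨U, hUf, hU0, hU⟩ := hmono (LinearMap.range f) (by rwa [Ne, LinearMap.range_eq_bot])
  obtain ⟨g, hgU, ⟨w, hw, hgw⟩, hg⟩ := exists_essential_ker_of_le_range hproj hsemi
    (f ∘ₗ (⊤ : Submodule R M).subtype) (W := U)
    (fun L _ hL => by
      obtain ⟨x, ⟨hx, hxL⟩, hx0⟩ := (Submodule.ne_bot_iff _).1 (hf L hL)
      exact ⟨⟨x, trivial⟩, hxL, fun h => hx0 (congrArg Subtype.val h), hx⟩)
    (hUf.trans (by rw [LinearMap.range_comp, Submodule.range_subtype, LinearMap.range_eq_map]))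
    hU0
  obtain ⟨x, ⟨hx, hxU⟩, hx0⟩ := (Submodule.ne_bot_iff _).1 (hg U hU0)
  have hinj := hU U le_rfl ((g ∘ₗ U.subtype).codRestrict U fun x => hgU ⟨x, rfl⟩)
    fun h => hgw (congrArg Subtype.val (LinearMap.congr_fun h ⟨w, hw⟩))
  refine hx0 (congrArg Subtype.val (@hinj ⟨x, hxU⟩ 0 (Subtype.ext ?_)))
  simpa using hx

theorem HasFinUdim.accLeftAnnihilators (hfin : HasFinUdim R M)
    (hproj : ProjectiveInSigmaM R M) (hsemi : IsSemiprimeModule R M)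
    (hZ : ∀ f : M →ₗ[R] M, IsEssentialSub R M (LinearMap.ker f) → f = 0) :
    AccLeftAnnihilators R M := by
  intro a ha hmono
  have hess : ∀ n (B : Submodule R M), a n < B → ∃ C ≤ B, C ≠ ⊥ ∧ Disjoint C (a n) := by
    intro n B hB
    by_contra! hc
    refine hB.not_ge ?_
    obtain ⟨X, hX⟩ := ha n
    rw [hX]
    refine le_iInf₂ fun f hf => ?_
    have haf : a n ≤ LinearMap.ker f := hX.trans_le (iInf₂_le f hf)
    suffices h : LinearMap.range (f ∘ₗ B.subtype) = ⊥ from fun x hx =>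
      LinearMap.congr_fun (LinearMap.range_eq_bot.1 h) ⟨x, hx⟩
    by_contra hW0
    obtain ⟨g, -, ⟨w, -, hgw⟩, hg⟩ := exists_essential_ker_of_le_range hproj hsemi
      (f ∘ₗ B.subtype) (fun L hL hL0 => by
        have h := hc L hL hL0
        rw [disjoint_iff] at h
        obtain ⟨x, ⟨hxL, hx⟩, hx0⟩ := (Submodule.ne_bot_iff _).1 h
        exact ⟨⟨x, hL hxL⟩, hxL, fun h => hx0 (congrArg Subtype.val h), haf hx⟩) le_rfl hW0
    exact hgw (by rw [hZ g hg, LinearMap.zero_apply])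
  by_contra! hc
  choose s hs hsa using hc
  let k : ℕ → ℕ := fun n => s^[n] 0
  have hk : ∀ n, a (k n) < a (k (n + 1)) := fun n => by
    simp only [k, Function.iterate_succ_apply']
    exact lt_of_le_of_ne (hmono (hs _)) (hsa _).symm
  choose C hCle hC0 hCd using fun n => hess (k n) _ (hk n)
  exact hfin.false_of_disjoint C (fun n => a (k n)) hC0 hCd fun m n hmn =>
    (hCle m).trans ((strictMono_nat_of_lt_succ hk).monotone hmn)

theorem IsGoldieModule.hasEnoughMonoforms (hG : IsGoldieModule R M)
    (hproj : ProjectiveInSigmaM R M) (hsemi : IsSemiprimeModule R M) :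
    HasEnoughMonoforms R M := by
  intro N hN
  obtain ⟨U, hUN, hU0, hU⟩ := hG.2.exists_uniform hN
  refine ⟨U, hUN, hU0, fun L hL f hf => ?_⟩
  by_contra hinj
  rw [← LinearMap.ker_eq_bot] at hinj
  have hK0 : (LinearMap.ker f).map L.subtype ≠ ⊥ := by
    rwa [Ne, ← le_bot_iff, Submodule.map_le_iff_le_comap, Submodule.comap_bot,
      L.ker_subtype, le_bot_iff]
  obtain ⟨g, -, ⟨w, -, hgw⟩, hg⟩ := exists_essential_ker_of_le_range hproj hsemi
    (U.subtype ∘ₗ f) (fun L' hL' hL0' => by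
      obtain ⟨_, ⟨⟨x, hx, rfl⟩, hxL⟩, hx0⟩ := (Submodule.ne_bot_iff _).1
        (hU _ L' ((Submodule.map_subtype_le _ _).trans hL) (hL'.trans hL) hK0 hL0')
      exact ⟨x, hxL, fun h => hx0 (by rw [h, map_zero]),
        by rw [LinearMap.comp_apply, LinearMap.mem_ker.1 hx, map_zero]⟩) le_rfl
    (fun h => hf (by
      ext x
      exact LinearMap.congr_fun (LinearMap.range_eq_bot.1 h) x))
  exact hgw (by rw [hG.1.eq_zero_of_essential_ker hproj hsemi g hg, LinearMap.zero_apply])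

end Helpers

/-- For `M` projective in `σ[M]` and semiprime: `M` has finite uniform
dimension and enough monoforms iff `M` is a Goldie module. -/
theorem stmt4 (R : Type u) [Ring R] (M : Type v) [AddCommGroup M] [Module R M]
    (hproj : ProjectiveInSigmaM R M) (hsemi : IsSemiprimeModule R M) :
    (HasFinUdim R M ∧ HasEnoughMonoforms R M) ↔ IsGoldieModule R M :=
  ⟨fun h => ⟨h.1.accLeftAnnihilators hproj hsemi
    (h.2.eq_zero_of_essential_ker hproj hsemi), h.1⟩,
    fun h => ⟨h.2, h.hasEnoughMonoforms hproj hsemi⟩⟩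
end

section
/- Let R be an associative unital ring and M a left R-module that is projective in σ[M] and semiprime, with finitely many minimal prime submodules P₁, …, P_t. Suppose every quotient M/P_i (1 ≤ i ≤ t) has finite uniform dimension. Then M is a Goldie module if and only if M/P_i is a Goldie module for every 1 ≤ i ≤ t (where the left annihilators of M/P_i are taken with respect to End_R(M/P_i)). -/
universe u v

section FinUdim

variable {R : Type*} [Ring R]

/-- A module is of finite uniform dimension if some linear map out of it has kernel and codomain
of finite uniform dimension. -/
theorem hasFinUdim_of_ker {X Y : Type*} [AddCommGroup X] [Module R X] [AddCommGroup Y] [Module R Y]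
    (g : X →ₗ[R] Y) (hker : HasFinUdim R (LinearMap.ker g)) (hY : HasFinUdim R Y) :
    HasFinUdim R X := by
  rintro ⟨f, hf0, hf⟩
  have hf : iSupIndep f := hf
  by_cases h : ∃ n₀, Disjoint (⨆ n ∈ Set.Ici n₀, f n) (LinearMap.ker g)
  · obtain ⟨n₀, hn₀⟩ := h
    have hle : ∀ n, f (n₀ + n) ≤ ⨆ n ∈ Set.Ici n₀, f n := fun n =>
      le_biSup f (Set.mem_Ici.2 (Nat.le_add_right n₀ n))
    refine hY ⟨fun n => (f (n₀ + n)).map g, fun n hn => ?_, fun n => ?_⟩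
    · replace hn : f (n₀ + n) ≤ LinearMap.ker g := LinearMap.le_ker_iff_map.2 hn
      exact hf0 (n₀ + n) (le_bot_iff.1 (hn₀ (hle n) hn))
    · simp_rw [← Submodule.map_iSup]
      rw [Submodule.disjoint_def]
      rintro _ ⟨a, ha, rfl⟩ ⟨b, hb, hab⟩
      have hb' : b ∈ ⨆ n ∈ Set.Ici n₀, f n := (iSup₂_le fun m _ => hle m :) hb
      have hk : a - b ∈ LinearMap.ker g := by simp [hab]
      have hz := (Submodule.disjoint_def.1 hn₀) _ (sub_mem (hle n ha) hb') hk
      rw [sub_eq_zero] at hz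
      subst hz
      have hb2 : a ∈ ⨆ (j) (_ : j ≠ n₀ + n), f j :=
        (iSup₂_le fun m hm => le_biSup f (by simpa using hm) :
          (⨆ (m) (_ : m ≠ n), f (n₀ + m)) ≤ ⨆ (j) (_ : j ∈ {j | j ≠ n₀ + n}), f j) hb
      rw [Submodule.disjoint_def.1 (hf (n₀ + n)) a ha hb2, map_zero]
  · have hstep : ∀ n₀, ∃ n₁, n₀ ≤ n₁ ∧
        (⨆ n ∈ Set.Ico n₀ n₁, f n) ⊓ LinearMap.ker g ≠ ⊥ := by
      intro n₀
      by_contra! hc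
      refine h ⟨n₀, disjoint_biSup_of_finite_disjoint_biSup fun t ht htf => ?_⟩
      obtain ⟨b, hb⟩ := htf.bddAbove
      refine (disjoint_iff.2 (hc (max n₀ (b + 1)) (le_max_left _ _))).mono_left
        (biSup_mono fun n hn => ⟨ht hn, ?_⟩)
      exact lt_max_of_lt_right (Nat.lt_succ_of_le (hb hn))
    choose nxt hnxt hne using hstep
    set a : ℕ → ℕ := fun k => nxt^[k] 0 with ha
    have ha_succ : ∀ k, a (k + 1) = nxt (a k) := fun k => Function.iterate_succ_apply' _ _ _
    have hmono : Monotone a := monotone_nat_of_le_succ fun k => by rw [ha_succ]; exact hnxt _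
    have hdisj := hmono.pairwise_disjoint_on_Ico_succ
    refine hker ⟨fun k => (⨆ n ∈ Set.Ico (a k) (a (k + 1)), f n).comap
      (LinearMap.ker g).subtype, fun k hk => ?_, fun k => ?_⟩
    · refine hne (a k) ?_
      rw [← ha_succ, eq_bot_iff]
      rintro x ⟨hx1, hx2⟩
      have hx : (⟨x, hx2⟩ : LinearMap.ker g) ∈ (⊥ : Submodule R (LinearMap.ker g)) := hk ▸ hx1
      simpa using hx
    · have hd := hf.disjoint_biSup_biSup (disjoint_compl_right (a := Set.Ico (a k) (a (k + 1))))
      rw [Submodule.disjoint_def] at hd ⊢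
      intro x hx hx'
      refine Subtype.ext (hd x hx ?_)
      suffices hle : (⨆ (m) (_ : m ≠ k), (⨆ n ∈ Set.Ico (a m) (a (m + 1)), f n).comap
          (LinearMap.ker g).subtype) ≤
          (⨆ n ∈ (Set.Ico (a k) (a (k + 1)))ᶜ, f n).comap (LinearMap.ker g).subtype from hle hx'
      refine iSup₂_le fun m hm => Submodule.comap_mono (biSup_mono fun n hn hn' => ?_)
      exact Set.disjoint_left.1 (hdisj hm) hn hn'

/-- A module of which finitely many maps into modules of finite uniform dimension are jointly
injective has finite uniform dimension. -/
theorem hasFinUdim_of_iInf_ker {ι Y : Type*} {Z : ι → Type*} [∀ i, AddCommGroup (Z i)]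
    [∀ i, Module R (Z i)] (hZ : ∀ i, HasFinUdim R (Z i)) (s : Finset ι) [AddCommGroup Y]
    [Module R Y] (g : ∀ i, Y →ₗ[R] Z i) (hg : ∀ y, (∀ i ∈ s, g i y = 0) → y = 0) :
    HasFinUdim R Y := by
  classical
  suffices h : ∀ N : Submodule R Y, (∀ y ∈ N, (∀ i ∈ s, g i y = 0) → y = 0) →
      HasFinUdim R N by
    refine hasFinUdim_of_ker (0 : Y →ₗ[R] (⊥ : Submodule R Y))
      (h _ fun y _ hy => hg y hy) (h ⊥ fun y hy _ => by simpa using hy)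
  clear hg
  induction s using Finset.induction_on with
  | empty =>
    rintro N hN ⟨f, hf, -⟩
    obtain ⟨x, -, hx⟩ := Submodule.exists_mem_ne_zero_of_ne_bot (hf 0)
    exact hx (Subtype.ext (hN x x.2 (by simp)))
  | insert a s _ ih =>
    intro N hN
    refine hasFinUdim_of_ker ((g a).comp N.subtype) ?_ (hZ a)
    have hK := ih (N ⊓ LinearMap.ker (g a)) fun y hy h => hN y hy.1 fun i hi => by
      rcases Finset.mem_insert.1 hi with rfl | hi
      exacts [hy.2, h i hi]
    let φ : LinearMap.ker ((g a).comp N.subtype) →ₗ[R] ↥(N ⊓ LinearMap.ker (g a)) :=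
      LinearMap.codRestrict _ (N.subtype.comp (Submodule.subtype _)) fun x => ⟨x.1.2, x.2⟩
    refine hasFinUdim_of_ker φ ?_ hK
    rintro ⟨f, hf, -⟩
    obtain ⟨x, -, hx⟩ := Submodule.exists_mem_ne_zero_of_ne_bot (hf 0)
    have hx0 := congrArg Subtype.val (LinearMap.mem_ker.1 x.2)
    exact hx (Subtype.ext (Subtype.ext (Subtype.ext hx0)))

end FinUdim

section Primes

variable {R : Type u} [Ring R] {M : Type v} [AddCommGroup M] [Module R M]

theorem prodM_le_iff {K L N : Submodule R M} :
    prodM R M K L ≤ N ↔ ∀ f : M →ₗ[R] M, LinearMap.range f ≤ L → K.map f ≤ N :=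
  iSup₂_le_iff

theorem prodM_mono {K K' L L' : Submodule R M} (hK : K ≤ K') (hL : L ≤ L') :
    prodM R M K L ≤ prodM R M K' L' :=
  prodM_le_iff.2 fun f hf => (Submodule.map_mono hK).trans
    (le_iSup₂_of_le (f := fun (f : M →ₗ[R] M) (_ : LinearMap.range f ≤ L') => K'.map f) f
      (hf.trans hL) le_rfl)

theorem prodM_le_left {K L : Submodule R M} (hK : IsFullyInvariant R M K) : prodM R M K L ≤ K :=
  prodM_le_iff.2 fun f _ => hK f

theorem prodM_le_right {K L : Submodule R M} : prodM R M K L ≤ L :=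
  prodM_le_iff.2 fun _ hf => LinearMap.map_le_range.trans hf

theorem IsFullyInvariant.sup {K L : Submodule R M} (hK : IsFullyInvariant R M K)
    (hL : IsFullyInvariant R M L) : IsFullyInvariant R M (K ⊔ L) := fun f => by
  rw [Submodule.map_sup]
  exact sup_le_sup (hK f) (hL f)

theorem IsFullyInvariant.inf {K L : Submodule R M} (hK : IsFullyInvariant R M K)
    (hL : IsFullyInvariant R M L) : IsFullyInvariant R M (K ⊓ L) := fun f =>
  (Submodule.map_inf_le f).trans (inf_le_inf (hK f) (hL f))

theorem IsFullyInvariant.sInf {c : Set (Submodule R M)} (hc : ∀ N ∈ c, IsFullyInvariant R M N) :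
    IsFullyInvariant R M (sInf c) := fun f =>
  le_sInf fun N hN => (Submodule.map_mono (sInf_le hN)).trans (hc N hN f)

theorem IsFullyInvariant.sSup {c : Set (Submodule R M)} (hc : ∀ N ∈ c, IsFullyInvariant R M N) :
    IsFullyInvariant R M (sSup c) := fun f => by
  rw [sSup_eq_iSup, Submodule.map_iSup]
  refine iSup_le fun N => ?_
  rw [Submodule.map_iSup]
  exact iSup_le fun hN => (hc N hN f).trans (le_iSup₂_of_le N hN le_rfl)

/-- The fully invariant submodule generated by an element. -/
def fullyInvariantSpan (x : M) : Submodule R M :=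
  ⨆ f : M →ₗ[R] M, (R ∙ x).map f

theorem fullyInvariantSpan_isFullyInvariant (x : M) :
    IsFullyInvariant R M (fullyInvariantSpan (R := R) x) := fun f => by
  unfold fullyInvariantSpan
  rw [Submodule.map_iSup]
  refine iSup_le fun g => ?_
  rw [← Submodule.map_comp]
  exact le_iSup (fun h : M →ₗ[R] M => (R ∙ x).map h) (f ∘ₗ g)

theorem mem_fullyInvariantSpan (x : M) : x ∈ fullyInvariantSpan (R := R) x :=
  Submodule.mem_iSup_of_mem LinearMap.id ⟨x, Submodule.mem_span_singleton_self x, rfl⟩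

theorem fullyInvariantSpan_le {N : Submodule R M} (hN : IsFullyInvariant R M N) {x : M}
    (hx : x ∈ N) : fullyInvariantSpan (R := R) x ≤ N :=
  iSup_le fun f =>
    (Submodule.map_mono ((Submodule.span_singleton_le_iff_mem x N).2 hx)).trans (hN f)

theorem inSigmaM_of_surjective {X : Type v} [AddCommGroup X] [Module R X] (g : M →ₗ[R] X)
    (hg : Function.Surjective g) : InSigmaM R M X := by
  refine ⟨X, _, _, ⟨PUnit, g ∘ₗ Finsupp.lapply PUnit.unit, fun x => ?_⟩, LinearMap.id,
    Function.injective_id⟩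
  obtain ⟨m, rfl⟩ := hg x
  exact ⟨Finsupp.single PUnit.unit m, by simp⟩

theorem inSigmaM_submodule (N : Submodule R M) : InSigmaM R M N := by
  obtain ⟨Y, _, _, hY, g, hg⟩ :=
    inSigmaM_of_surjective (LinearMap.id : M →ₗ[R] M) Function.surjective_id
  exact ⟨Y, _, _, hY, g ∘ₗ N.subtype, hg.comp N.injective_subtype⟩

theorem inSigmaM_submodule_prod (K L : Submodule R M) : InSigmaM R M (K × L) := by
  refine ⟨M × M, _, _, ⟨ULift Bool, (Finsupp.lapply ⟨true⟩).prod (Finsupp.lapply ⟨false⟩),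
    fun x => ⟨Finsupp.single ⟨true⟩ x.1 + Finsupp.single ⟨false⟩ x.2, ?_⟩⟩,
    K.subtype.prodMap L.subtype, ?_⟩
  · ext <;> simp
  · exact Function.Injective.prodMap K.injective_subtype L.injective_subtype

/-- If `M` is projective in `σ[M]`, then maps into a sum of submodules decompose. -/
theorem ProjectiveInSigmaM.exists_add (hproj : ProjectiveInSigmaM R M) {K L : Submodule R M}
    (f : M →ₗ[R] M) (hf : LinearMap.range f ≤ K ⊔ L) :
    ∃ f₁ f₂ : M →ₗ[R] M, LinearMap.range f₁ ≤ K ∧ LinearMap.range f₂ ≤ L ∧ f = f₁ + f₂ := by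
  let g : (K × L) →ₗ[R] ↥(K ⊔ L) :=
    (Submodule.inclusion le_sup_left).coprod (Submodule.inclusion le_sup_right)
  have hg : Function.Surjective g := by
    rintro ⟨x, hx⟩
    obtain ⟨y, hy, z, hz, rfl⟩ := Submodule.mem_sup.1 hx
    exact ⟨(⟨y, hy⟩, ⟨z, hz⟩), Subtype.ext (by simp [g])⟩
  obtain ⟨h, hh⟩ := hproj _ _ (inSigmaM_submodule_prod K L) (inSigmaM_submodule (K ⊔ L)) g hg
    (f.codRestrict _ fun x => hf ⟨x, rfl⟩)
  refine ⟨K.subtype ∘ₗ LinearMap.fst R K L ∘ₗ h, L.subtype ∘ₗ LinearMap.snd R K L ∘ₗ h, ?_, ?_, ?_⟩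
  · rintro _ ⟨x, rfl⟩
    exact (h x).1.2
  · rintro _ ⟨x, rfl⟩
    exact (h x).2.2
  · ext x
    simpa [g] using (congrArg Subtype.val (LinearMap.congr_fun hh x)).symm

/-- If `M` is projective in `σ[M]`, endomorphisms of quotients of `M` lift to `M`. -/
theorem ProjectiveInSigmaM.exists_lift_s5 (hproj : ProjectiveInSigmaM R M) (N : Submodule R M)
    (f : (M ⧸ N) →ₗ[R] (M ⧸ N)) : ∃ f' : M →ₗ[R] M, N.mkQ ∘ₗ f' = f ∘ₗ N.mkQ :=
  hproj _ _ (inSigmaM_of_surjective LinearMap.id Function.surjective_id)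
    (inSigmaM_of_surjective N.mkQ N.mkQ_surjective) N.mkQ N.mkQ_surjective _

theorem ProjectiveInSigmaM.prodM_sup_le (hproj : ProjectiveInSigmaM R M) {N K L : Submodule R M}
    (hN : IsFullyInvariant R M N) :
    prodM R M (N ⊔ K) (N ⊔ L) ≤ N ⊔ prodM R M K L := by
  refine prodM_le_iff.2 fun f hf => ?_
  rw [Submodule.map_sup]
  refine sup_le ((hN f).trans le_sup_left) ?_
  obtain ⟨f₁, f₂, h₁, h₂, rfl⟩ := hproj.exists_add f hf
  rintro _ ⟨x, hx, rfl⟩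
  exact Submodule.add_mem_sup (h₁ ⟨x, rfl⟩)
    (prodM_le_iff.1 le_rfl f₂ h₂ (Submodule.mem_map_of_mem hx))

/-- In a semiprime module projective in `σ[M]`, a nonzero element avoids some prime submodule. -/
theorem exists_isPrimeSubmodule_notMem (hproj : ProjectiveInSigmaM R M)
    (hsemi : IsSemiprimeModule R M) {x : M} (hx : x ≠ 0) :
    ∃ Q : Submodule R M, IsPrimeSubmodule R M Q ∧ x ∉ Q := by
  have hstep : ∀ y : {y : M // y ≠ 0}, ∃ z : {z : M // z ≠ 0}, (z : M) ∈
      prodM R M (fullyInvariantSpan (R := R) (y : M)) (fullyInvariantSpan (R := R) (y : M)) := by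
    rintro ⟨y, hy⟩
    by_contra! hc
    have hbot := hsemi.2 _ (fullyInvariantSpan_isFullyInvariant (R := R) y) fun z hz => by
      by_contra hz0
      exact hc ⟨z, hz0⟩ hz
    exact hy (by simpa using hbot (mem_fullyInvariantSpan y))
  choose nxt hnxt using hstep
  let s : ℕ → {y : M // y ≠ 0} := fun n => nxt^[n] ⟨x, hx⟩
  have hs : ∀ n, (s (n + 1) : M) ∈ prodM R M (fullyInvariantSpan (R := R) (s n : M))
      (fullyInvariantSpan (R := R) (s n : M)) := fun n => by
    simp only [s, Function.iterate_succ_apply']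
    exact hnxt _
  have hmem : ∀ N : Submodule R M, IsFullyInvariant R M N → ∀ i j, i ≤ j → (s i : M) ∈ N →
      (s j : M) ∈ N := by
    intro N hN i j hij hi
    induction j, hij using Nat.le_induction with
    | base => exact hi
    | succ j _ ih => exact fullyInvariantSpan_le hN ih (prodM_le_right (hs j))
  obtain ⟨Q, -, hQ⟩ := zorn_le_nonempty₀
    {N : Submodule R M | IsFullyInvariant R M N ∧ ∀ n, (s n : M) ∉ N}
    (fun c hc hchain y hy => ⟨sSup c, ⟨IsFullyInvariant.sSup fun N hN => (hc hN).1, fun n hn => by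
      obtain ⟨N, hN, hnN⟩ := (Submodule.mem_sSup_of_directed ⟨y, hy⟩ hchain.directedOn).1 hn
      exact (hc hN).2 n hnN⟩, fun z hz => le_sSup hz⟩)
    ⊥ ⟨fun f => by simp, fun n hn => (s n).2 (by simpa using hn)⟩
  have key : ∀ K : Submodule R M, IsFullyInvariant R M K → ¬ K ≤ Q →
      ∃ n, (s n : M) ∈ Q ⊔ K := by
    intro K hK hKQ
    by_contra! hc
    exact hKQ (le_sup_right.trans (hQ.2 ⟨hQ.1.1.sup hK, hc⟩ le_sup_left))
  refine ⟨Q, ⟨hQ.1.1, fun K L hK hL hKL => ?_⟩, hQ.1.2 0⟩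
  by_contra! hc
  obtain ⟨i, hi⟩ := key K hK hc.1
  obtain ⟨j, hj⟩ := key L hL hc.2
  have hi' := hmem _ (hQ.1.1.sup hK) i (max i j) (le_max_left _ _) hi
  have hj' := hmem _ (hQ.1.1.sup hL) j (max i j) (le_max_right _ _) hj
  refine hQ.1.2 (max i j + 1) ?_
  have h := (prodM_mono (fullyInvariantSpan_le (hQ.1.1.sup hK) hi')
    (fullyInvariantSpan_le (hQ.1.1.sup hL) hj')).trans (hproj.prodM_sup_le hQ.1.1) (hs _)
  rwa [sup_eq_left.2 hKL] at h

/-- Every prime submodule contains a minimal prime submodule. -/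
theorem IsPrimeSubmodule.exists_isMinimalPrimeSubmodule_le {Q : Submodule R M}
    (hQ : IsPrimeSubmodule R M Q) : ∃ P ≤ Q, IsMinimalPrimeSubmodule R M P := by
  obtain ⟨P, hPQ, hP⟩ := zorn_le_nonempty₀ (α := (Submodule R M)ᵒᵈ)
    {N | IsPrimeSubmodule R M (OrderDual.ofDual N)} (fun c hc hchain y hy => by
      let c' : Set (Submodule R M) := OrderDual.toDual ⁻¹' c
      refine ⟨OrderDual.toDual (sInf c'), ⟨IsFullyInvariant.sInf fun N hN => (hc hN).1,
        fun K L hK hL hKL => ?_⟩, fun z hz => OrderDual.le_toDual.2 (sInf_le (show OrderDual.ofDual z ∈ c' from hz))⟩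
      by_contra! h
      obtain ⟨hKc, hLc⟩ := h
      simp only [OrderDual.ofDual_toDual, le_sInf_iff, not_forall] at hKc hLc
      obtain ⟨N₁, h₁, hK₁⟩ := hKc
      obtain ⟨N₂, h₂, hL₂⟩ := hLc
      rcases hchain.total h₁ h₂ with h | h
      · rcases (hc h₂).2 K L hK hL (hKL.trans (sInf_le h₂)) with h' | h'
        exacts [hK₁ (h'.trans h), hL₂ h']
      · rcases (hc h₁).2 K L hK hL (hKL.trans (sInf_le h₁)) with h' | h'
        exacts [hK₁ h', hL₂ (h'.trans h)])
    (OrderDual.toDual Q) hQ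
  exact ⟨OrderDual.ofDual P, hPQ, hP.1, fun N hN hNP => le_antisymm hNP (hP.2 hN hNP)⟩

theorem IsPrimeSubmodule.exists_le_of_finsetInf_le {ι : Type*} {Q : Submodule R M}
    (hQ : IsPrimeSubmodule R M Q) {P : ι → Submodule R M} (s : Finset ι)
    (hP : ∀ i, IsFullyInvariant R M (P i)) (h : s.inf P ≤ Q) :
    Q = ⊤ ∨ ∃ i ∈ s, P i ≤ Q := by
  classical
  induction s using Finset.induction_on with
  | empty => exact Or.inl (top_le_iff.1 (by simpa using h))
  | insert a s _ ih =>
    have hs : IsFullyInvariant R M (s.inf P) :=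
      Finset.inf_induction (fun f => le_top) (fun _ h₁ _ h₂ => h₁.inf h₂) fun i _ => hP i
    rw [Finset.inf_insert] at h
    rcases hQ.2 _ _ (hP a) hs
      ((le_inf (prodM_le_left (hP a)) prodM_le_right).trans h) with h' | h'
    · exact Or.inr ⟨a, Finset.mem_insert_self _ _, h'⟩
    · rcases ih h' with h'' | ⟨i, hi, hle⟩
      exacts [Or.inl h'', Or.inr ⟨i, Finset.mem_insert_of_mem hi, hle⟩]

theorem mem_annM_iff {K : Submodule R M} {m : M} :
    m ∈ annM R M K ↔ ∀ h : M →ₗ[R] M, LinearMap.range h ≤ K → h m = 0 := by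
  simp [annM]

theorem annM_isFullyInvariant (K : Submodule R M) : IsFullyInvariant R M (annM R M K) := by
  rintro f _ ⟨x, hx, rfl⟩
  exact mem_annM_iff.2 fun h hh =>
    mem_annM_iff.1 hx (h ∘ₗ f) ((LinearMap.range_comp_le_range f h).trans hh)

theorem prodM_annM (K : Submodule R M) : prodM R M (annM R M K) K = ⊥ := by
  refine le_bot_iff.1 (prodM_le_iff.2 ?_)
  rintro f hf _ ⟨x, hx, rfl⟩
  exact mem_annM_iff.1 hx f hf

/-- If finitely many minimal primes intersect in zero, each of them is an annihilator. -/
theorem exists_eq_annM {ι : Type*} [Fintype ι] {P : ι → Submodule R M}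
    (hP : ∀ i, IsMinimalPrimeSubmodule R M (P i)) (hbot : ∀ m, (∀ i, m ∈ P i) → m = 0) (i : ι) :
    ∃ K : Submodule R M, P i = annM R M K := by
  classical
  refine ⟨(Finset.univ.filter fun j => P j ≠ P i).inf P, le_antisymm (fun m hm => ?_) ?_⟩
  · refine mem_annM_iff.2 fun h hh => hbot _ fun j => ?_
    by_cases hj : P j = P i
    · rw [hj]
      exact (hP i).1.1 h (Submodule.mem_map_of_mem hm)
    · exact hh.trans (Finset.inf_le (by simpa using hj)) ⟨m, rfl⟩
  · have hfi : IsFullyInvariant R M ((Finset.univ.filter fun j => P j ≠ P i).inf P) :=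
      Finset.inf_induction (fun f => le_top) (fun _ h₁ _ h₂ => h₁.inf h₂) fun j _ => (hP j).1.1
    rcases (hP i).1.2 _ _ (annM_isFullyInvariant _) hfi ((prodM_annM _).trans_le bot_le)
      with h | h
    · exact h
    · rcases (hP i).1.exists_le_of_finsetInf_le _ (fun j => (hP j).1.1) h with h | ⟨j, hj, hle⟩
      · exact h ▸ le_top
      · exact absurd ((hP i).2 _ (hP j).1 hle) (Finset.mem_filter.1 hj).2

end Primes

section Acc

variable {R : Type u} [Ring R] {M : Type v} [AddCommGroup M] [Module R M]

theorem isLeftAnnihilatorSub_iff {N : Submodule R M} :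
    IsLeftAnnihilatorSub R M N ↔
      ∀ m, (∀ f : M →ₗ[R] M, N ≤ LinearMap.ker f → f m = 0) → m ∈ N := by
  constructor
  · rintro ⟨X, rfl⟩ m hm
    simp only [Submodule.mem_iInf, LinearMap.mem_ker]
    exact fun f hf => hm f (iInf₂_le f hf)
  · refine fun h => ⟨{f | N ≤ LinearMap.ker f}, le_antisymm (le_iInf₂ fun f hf => hf) fun m hm => ?_⟩
    simp only [Submodule.mem_iInf, LinearMap.mem_ker] at hm
    exact h m hm

theorem accLeftAnnihilators_quotient (hproj : ProjectiveInSigmaM R M)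
    (hacc : AccLeftAnnihilators R M) (K : Submodule R M) :
    AccLeftAnnihilators R (M ⧸ annM R M K) := by
  intro a ha hmono
  have hann : ∀ n, IsLeftAnnihilatorSub R M ((a n).comap (annM R M K).mkQ) := by
    refine fun n => isLeftAnnihilatorSub_iff.2 fun m hm =>
      isLeftAnnihilatorSub_iff.1 (ha n) _ fun f hf => ?_
    obtain ⟨f', hf'⟩ := hproj.exists_lift_s5 _ f
    have hf'x : ∀ x, (annM R M K).mkQ (f' x) = f ((annM R M K).mkQ x) := LinearMap.congr_fun hf'
    rw [← hf'x, Submodule.mkQ_apply, Submodule.Quotient.mk_eq_zero, mem_annM_iff]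
    refine fun h hh => hm (h ∘ₗ f') fun x hx => ?_
    have h0 : (annM R M K).mkQ (f' x) = 0 := (hf'x x).trans (hf hx)
    rw [Submodule.mkQ_apply, Submodule.Quotient.mk_eq_zero, mem_annM_iff] at h0
    exact h0 h hh
  obtain ⟨n, hn⟩ := hacc _ hann fun i j hij => Submodule.comap_mono (hmono hij)
  exact ⟨n, fun m hm =>
    Submodule.comap_injective_of_surjective (annM R M K).mkQ_surjective (hn m hm)⟩

theorem accLeftAnnihilators_of_quotients {ι : Type*} [Fintype ι] {P : ι → Submodule R M}
    (hP : ∀ i, IsFullyInvariant R M (P i)) (hbot : ∀ m, (∀ i, m ∈ P i) → m = 0)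
    (hacc : ∀ i, AccLeftAnnihilators R (M ⧸ P i)) : AccLeftAnnihilators R M := by
  intro a ha hmono
  let q (i : ι) (f : M →ₗ[R] M) : (M ⧸ P i) →ₗ[R] (M ⧸ P i) :=
    (P i).mapQ (P i) f (Submodule.map_le_iff_le_comap.1 (hP i f))
  let b (i : ι) (n : ℕ) : Submodule R (M ⧸ P i) :=
    ⨅ g ∈ q i '' {f | a n ≤ LinearMap.ker f}, LinearMap.ker g
  have hb : ∀ i n m, (P i).mkQ m ∈ b i n ↔
      ∀ f : M →ₗ[R] M, a n ≤ LinearMap.ker f → f m ∈ P i := by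
    intro i n m
    simp [b, q, Submodule.mem_iInf, Submodule.Quotient.mk_eq_zero]
  have hab : ∀ n m, m ∈ a n ↔ ∀ i, (P i).mkQ m ∈ b i n := by
    intro n m
    refine ⟨fun hm i => (hb i n m).2 fun f hf => ?_, fun hm =>
      isLeftAnnihilatorSub_iff.1 (ha n) m fun f hf => hbot _ fun i => (hb i n m).1 (hm i) f hf⟩
    rw [LinearMap.mem_ker.1 (hf hm)]
    exact zero_mem _
  have hstab : ∀ i, ∃ n, ∀ m, n ≤ m → b i m = b i n := fun i =>
    hacc i (b i) (fun n => ⟨_, rfl⟩) fun n m hnm =>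
      biInf_mono (Set.image_mono fun f hf => (hmono hnm).trans hf)
  choose N hN using hstab
  refine ⟨Finset.univ.sup N, fun m hm => ?_⟩
  ext x
  rw [hab, hab]
  refine forall_congr' fun i => ?_
  have hi : N i ≤ Finset.univ.sup N := Finset.le_sup (Finset.mem_univ i)
  rw [hN i m (hi.trans hm), hN i _ hi]

end Acc

/-- For `M` projective in `σ[M]` and semiprime with finitely many minimal
prime submodules `P 1, …, P t`, each quotient of finite uniform dimension: `M` is Goldie
iff each `M ⧸ P i` is Goldie. -/
theorem stmt5 (R : Type u) [Ring R] (M : Type v) [AddCommGroup M] [Module R M]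
    (hproj : ProjectiveInSigmaM R M) (hsemi : IsSemiprimeModule R M)
    (t : ℕ) (P : Fin t → Submodule R M)
    (hPmin : ∀ i, IsMinimalPrimeSubmodule R M (P i))
    (hPall : ∀ Q : Submodule R M, IsMinimalPrimeSubmodule R M Q → ∃ i, Q = P i)
    (hquot : ∀ i, HasFinUdim R (M ⧸ P i)) :
    IsGoldieModule R M ↔ ∀ i, IsGoldieModule R (M ⧸ P i) := by
  have hbot : ∀ m, (∀ i, m ∈ P i) → m = 0 := fun m hm => by
    by_contra hm0
    obtain ⟨Q, hQ, hmQ⟩ := exists_isPrimeSubmodule_notMem hproj hsemi hm0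
    obtain ⟨P', hle, hP'⟩ := hQ.exists_isMinimalPrimeSubmodule_le
    obtain ⟨i, rfl⟩ := hPall P' hP'
    exact hmQ (hle (hm i))
  refine ⟨fun h i => ⟨?_, hquot i⟩, fun h => ⟨?_, ?_⟩⟩
  · obtain ⟨K, hK⟩ := exists_eq_annM hPmin hbot i
    rw [hK]
    exact accLeftAnnihilators_quotient hproj h.1 K
  · exact accLeftAnnihilators_of_quotients (fun i => (hPmin i).1.1) hbot fun i => (h i).1
  · exact hasFinUdim_of_iInf_ker hquot Finset.univ (fun i => (P i).mkQ) fun m hm =>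
      hbot m fun i => by simpa using hm i (Finset.mem_univ i)
end

section
/- Let R be an associative unital ring and M a retractable left R-module. The following are equivalent: (a) M is semisimple and artinian; (b) M is semiprime and artinian; (c) M is semiprime and satisfies the descending chain condition on cyclic submodules and on direct summands. -/
universe u v

/-- The descending chain condition on the elements satisfying `P` yields minimal elements of
every nonempty predicate implying `P`. -/
theorem exists_minimal_of_dcc {α : Type*} [PartialOrder α] {P Q : α → Prop}
    (h : ∀ a : ℕ → α, (∀ n, P (a n)) → Antitone a → ∃ n, ∀ m, n ≤ m → a m = a n)
    (hQP : ∀ x, Q x → P x) (hQ : ∃ x, Q x) : ∃ x, Minimal Q x := by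
  by_contra! hmin
  have step : ∀ x : {x // Q x}, ∃ y : {x // Q x}, y.1 < x.1 := by
    rintro ⟨x, hx⟩
    have hx' := hmin x
    rw [not_minimal_iff_exists_lt hx] at hx'
    obtain ⟨y, hyx, hy⟩ := hx'
    exact ⟨⟨y, hy⟩, hyx⟩
  choose next hnext using step
  obtain ⟨x, hx⟩ := hQ
  let a : ℕ → {x // Q x} := fun n ↦ next^[n] ⟨x, hx⟩
  have ha : ∀ n, (a (n + 1)).1 < (a n).1 := fun n ↦ by
    simpa only [a, Function.iterate_succ_apply'] using hnext (a n)
  obtain ⟨n, hn⟩ := h (fun n ↦ (a n).1) (fun n ↦ hQP _ (a n).2)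
    (antitone_nat_of_succ_le fun n ↦ (ha n).le)
  exact (ha n).ne (hn (n + 1) n.le_succ)

section SemiprimeModules

variable {R : Type u} [Ring R] {M : Type v} [AddCommGroup M] [Module R M]

/-- Under DCC on cyclic submodules every nonzero submodule contains a simple one. -/
theorem exists_isAtom_le_of_dcc_cyclic
    (h : ∀ a : ℕ → Submodule R M, (∀ n, ∃ m : M, a n = Submodule.span R {m}) →
      Antitone a → ∃ n, ∀ m, n ≤ m → a m = a n)
    {N : Submodule R M} (hN : N ≠ ⊥) : ∃ S ≤ N, IsAtom S := by
  obtain ⟨x, hxN, hx⟩ := N.ne_bot_iff.mp hN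
  obtain ⟨S, ⟨-, hS, hSN⟩, hmin⟩ := exists_minimal_of_dcc
    (Q := fun S ↦ (∃ m : M, S = Submodule.span R {m}) ∧ S ≠ ⊥ ∧ S ≤ N) h (fun _ hS ↦ hS.1)
    ⟨Submodule.span R {x}, ⟨x, rfl⟩, by simpa using hx, by simpa using hxN⟩
  refine ⟨S, hSN, hS, fun T hT ↦ ?_⟩
  by_contra hT0
  obtain ⟨y, hyT, hy⟩ := T.ne_bot_iff.mp hT0
  have hle : Submodule.span R {y} ≤ T := by simpa using hyT
  exact hT.not_ge ((hmin ⟨⟨y, rfl⟩, by simpa using hy, (hle.trans hT.le).trans hSN⟩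
    (hle.trans hT.le)).trans hle)

theorem isFullyInvariant_iSup_map (N : Submodule R M) :
    IsFullyInvariant R M (⨆ g : M →ₗ[R] M, N.map g) := by
  intro f
  rw [Submodule.map_iSup]
  refine iSup_le fun g ↦ ?_
  rw [← Submodule.map_comp]
  exact le_iSup (fun g : M →ₗ[R] M ↦ N.map g) (f ∘ₗ g)

/-- In a semiprime module every simple submodule is a direct summand. -/
theorem IsSemiprimeModule.exists_isCompl_of_isAtom (hM : IsSemiprimeModule R M)
    {S : Submodule R M} (hS : IsAtom S) : ∃ K, IsCompl S K := by
  have : IsSimpleModule R S := isSimpleModule_iff_isAtom.mpr hS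
  let K : Submodule R M := ⨆ g : M →ₗ[R] M, S.map g
  have hSK : S ≤ K := by
    simpa using le_iSup (fun g : M →ₗ[R] M ↦ S.map g) LinearMap.id
  have : IsSemisimpleModule R K := by
    have hmap : ∀ g : M →ₗ[R] M, IsSemisimpleModule R (S.map g) := fun g ↦ by
      rw [← LinearMap.range_domRestrict]
      exact .range _
    rw [show K = ⨆ g ∈ Set.univ, S.map g from iSup_univ.symm]
    exact isSemisimpleModule_biSup_of_isSemisimpleModule_submodule fun g _ ↦ hmap g
  have hK : ¬ prodM R M K K ≤ ⊥ := fun h ↦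
    hS.1 (le_bot_iff.mp (hSK.trans (hM.2 K (isFullyInvariant_iSup_map S) h)))
  obtain ⟨f, hf, g, hfg⟩ : ∃ f : M →ₗ[R] M, LinearMap.range f ≤ K ∧
      ∃ g : M →ₗ[R] M, ¬ (S.map g).map f ≤ ⊥ := by
    simpa only [prodM, K, Submodule.map_iSup, iSup_le_iff, not_forall, exists_prop] using hK
  let φ : M →ₗ[R] K := (f ∘ₗ g).codRestrict K fun x ↦ hf ⟨g x, rfl⟩
  have hφ : φ ∘ₗ S.subtype ≠ 0 := by
    intro h0
    apply hfg
    rintro _ ⟨_, ⟨x, hx, rfl⟩, rfl⟩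
    exact congrArg Subtype.val (LinearMap.congr_fun h0 ⟨x, hx⟩)
  obtain ⟨r, hr⟩ := IsSemisimpleModule.extension_property (φ ∘ₗ S.subtype)
    (LinearMap.injective_of_ne_zero hφ) LinearMap.id
  exact ⟨LinearMap.ker (r ∘ₗ φ), LinearMap.isCompl_of_proj fun x ↦ LinearMap.congr_fun hr x⟩

/-- A module whose nonzero submodules all contain a simple direct summand is semisimple as soon
as it satisfies DCC on direct summands. -/
theorem isSemisimpleModule_of_dcc_summands
    (hatom : ∀ N : Submodule R M, N ≠ ⊥ → ∃ S ≤ N, IsAtom S ∧ ∃ K, IsCompl S K)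
    (h : ∀ a : ℕ → Submodule R M, (∀ n, ∃ K : Submodule R M, IsCompl (a n) K) →
      Antitone a → ∃ n, ∀ m, n ≤ m → a m = a n) :
    IsSemisimpleModule R M := by
  have hbot : IsSemisimpleModule R (⊥ : Submodule R M) :=
    { exists_isCompl := fun x ↦ ⟨⊤, Subsingleton.elim ⊥ x ▸ isCompl_bot_top⟩ }
  obtain ⟨A, ⟨K, hAK, hK⟩, hmin⟩ := exists_minimal_of_dcc
    (P := fun A : Submodule R M ↦ ∃ K, IsCompl A K)
    (Q := fun A : Submodule R M ↦ ∃ K : Submodule R M, IsCompl A K ∧ IsSemisimpleModule R K) h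
    (fun _ ⟨K, hK, _⟩ ↦ ⟨K, hK⟩) ⟨⊤, ⊥, isCompl_top_bot, hbot⟩
  by_cases hA : A = ⊥
  · obtain rfl : K = ⊤ := by simpa [hA] using hAK.sup_eq_top
    exact .congr Submodule.topEquiv.symm
  obtain ⟨S, hSA, hS, T, hST⟩ := hatom A hA
  have : IsSimpleModule R S := isSimpleModule_iff_isAtom.mpr hS
  have hsup : S ⊔ A ⊓ T = A := by
    rw [inf_comm, ← sup_inf_assoc_of_le T hSA, hST.sup_eq_top, top_inf_eq]
  have hcompl : IsCompl (A ⊓ T) (S ⊔ K) := by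
    refine ⟨?_, ?_⟩
    · refine Disjoint.disjoint_sup_right_of_disjoint_sup_left ?_ ?_
      · exact hST.disjoint.symm.mono_left inf_le_right
      · rw [sup_comm, hsup]
        exact hAK.disjoint
    · rw [codisjoint_iff, ← sup_assoc, sup_comm (A ⊓ T), hsup, hAK.sup_eq_top]
  have hAT : A ≤ T := (hmin ⟨S ⊔ K, hcompl, .sup inferInstance hK⟩ inf_le_left).trans inf_le_right
  exact absurd (hST.disjoint.eq_bot_of_le (hSA.trans hAT)) hS.1

theorem IsSemisimpleModule.isSemiprimeModule [IsSemisimpleModule R M] :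
    IsSemiprimeModule R M := by
  refine ⟨fun f ↦ by simp, fun K _ hK ↦ le_trans ?_ hK⟩
  obtain ⟨r, hr⟩ := IsSemisimpleModule.extension_property K.subtype K.injective_subtype
    LinearMap.id
  refine le_trans (fun x hx ↦ ?_) (le_iSup₂_of_le (K.subtype ∘ₗ r) ?_ le_rfl)
  · exact ⟨x, hx, congrArg Subtype.val (LinearMap.congr_fun hr ⟨x, hx⟩)⟩
  · rintro _ ⟨x, rfl⟩
    exact (r x).2

theorem IsArtinian.antitone_stabilizes [IsArtinian R M] (a : ℕ → Submodule R M)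
    (ha : Antitone a) : ∃ n, ∀ m, n ≤ m → a m = a n := by
  obtain ⟨n, hn⟩ := IsArtinian.monotone_stabilizes (R := R) (M := M) ⟨a, ha⟩
  exact ⟨n, fun m hm ↦ (hn m hm).symm⟩

theorem isArtinian_of_antitone_stabilizes
    (h : ∀ a : ℕ → Submodule R M, Antitone a → ∃ n, ∀ m, n ≤ m → a m = a n) :
    IsArtinian R M := by
  refine monotone_stabilizes_iff_artinian.mp fun f ↦ ?_
  obtain ⟨n, hn⟩ := h f f.monotone
  exact ⟨n, fun m hm ↦ (hn m hm).symm⟩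

theorem IsSemiprimeModule.isSemisimpleModule_of_dcc (hM : IsSemiprimeModule R M)
    (hcyc : ∀ a : ℕ → Submodule R M, (∀ n, ∃ m : M, a n = Submodule.span R {m}) →
      Antitone a → ∃ n, ∀ m, n ≤ m → a m = a n)
    (hsum : ∀ a : ℕ → Submodule R M, (∀ n, ∃ K : Submodule R M, IsCompl (a n) K) →
      Antitone a → ∃ n, ∀ m, n ≤ m → a m = a n) :
    IsSemisimpleModule R M := by
  refine isSemisimpleModule_of_dcc_summands (fun N hN ↦ ?_) hsum
  obtain ⟨S, hSN, hS⟩ := exists_isAtom_le_of_dcc_cyclic hcyc hN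
  exact ⟨S, hSN, hS, hM.exists_isCompl_of_isAtom hS⟩

end SemiprimeModules

/-- For a retractable module `M`, the following are equivalent:
(a) semisimple artinian; (b) semiprime artinian; (c) semiprime with DCC on cyclic
submodules and on direct summands. -/
theorem stmt7 (R : Type u) [Ring R] (M : Type v) [AddCommGroup M] [Module R M]
    (hret : Retractable R M) :
    ((IsSemisimpleModule R M ∧ IsArtinian R M) ↔
        (IsSemiprimeModule R M ∧ IsArtinian R M)) ∧
    ((IsSemiprimeModule R M ∧ IsArtinian R M) ↔
        (IsSemiprimeModule R M ∧
          (∀ a : ℕ → Submodule R M, (∀ n, ∃ m : M, a n = Submodule.span R {m}) →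
            Antitone a → ∃ n, ∀ m, n ≤ m → a m = a n) ∧
          (∀ a : ℕ → Submodule R M, (∀ n, ∃ K : Submodule R M, IsCompl (a n) K) →
            Antitone a → ∃ n, ∀ m, n ≤ m → a m = a n))) := by
  refine ⟨⟨fun ⟨_, hart⟩ ↦ ⟨IsSemisimpleModule.isSemiprimeModule, hart⟩,
    fun ⟨hM, hart⟩ ↦ ⟨?_, hart⟩⟩, fun ⟨hM, hart⟩ ↦ ⟨hM, ?_, ?_⟩,
    fun ⟨hM, hcyc, hsum⟩ ↦ ⟨hM, ?_⟩⟩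
  · exact hM.isSemisimpleModule_of_dcc (fun a _ ↦ IsArtinian.antitone_stabilizes a)
      (fun a _ ↦ IsArtinian.antitone_stabilizes a)
  · exact fun a _ ↦ IsArtinian.antitone_stabilizes a
  · exact fun a _ ↦ IsArtinian.antitone_stabilizes a
  · have := hM.isSemisimpleModule_of_dcc hcyc hsum
    exact isArtinian_of_antitone_stabilizes fun a ↦ hsum a fun n ↦ exists_isCompl (a n)
end
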